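/- Fix m ≥ 1. In the polynomial ring ℚ[α, β, γ], define c₀ = 1, c₁ = α, c₂ = α²/2, and for n ≥ 3, n·c_n = α·c_{n−1} + (n−2)·β·c_{n−2} + 2·γ·c_{n−3}; let I_m be the ideal generated by c_{m+1}, c_{m+2}, c_{m+3}, and set ξ = αβ + 2γ. Then the residues modulo I_m of the monomials α^i β^j ξ^k, where (i, j, k) ranges over all triples of natural numbers satisfying (1) i + 2k ≤ m, (2) j + 2k ≤ m, and (3) if k = 0 then j < ⌊m/2⌋, are linearly independent in the quotient ring ℚ[α, β, γ]/I_m. -/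

import Mathlib

open MvPolynomial

/-- The sequence `c₀ = 1`, `c₁ = α`, `c₂ = α²/2`,
`n·c_n = α·c_{n−1} + (n−2)·β·c_{n−2} + 2·γ·c_{n−3}` for `n ≥ 3`, in `ℚ[α, β, γ]`
(with `α = X 0`, `β = X 1`, `γ = X 2`). -/
noncomputable def cseq : ℕ → MvPolynomial (Fin 3) ℚ
  | 0 => 1
  | 1 => X 0
  | 2 => C (1 / 2 : ℚ) * X 0 ^ 2
  | (n + 3) =>
      C (((n : ℚ) + 3)⁻¹) *
        (X 0 * cseq (n + 2) + C ((n : ℚ) + 1) * X 1 * cseq (n + 1) + 2 * X 2 * cseq n)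

/-- The ideal `I_k = (c_{k+1}, c_{k+2}, c_{k+3})` of `ℚ[α, β, γ]`. -/
noncomputable def cIdeal (k : ℕ) : Ideal (MvPolynomial (Fin 3) ℚ) :=
  Ideal.span {cseq (k + 1), cseq (k + 2), cseq (k + 3)}

/-- `ξ = αβ + 2γ`. -/
noncomputable def xiPoly : MvPolynomial (Fin 3) ℚ := X 0 * X 1 + 2 * X 2

local notation "α" => (X 0 : MvPolynomial (Fin 3) ℚ)
local notation "β" => (X 1 : MvPolynomial (Fin 3) ℚ)
local notation "γ" => (X 2 : MvPolynomial (Fin 3) ℚ)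

lemma C_inv_mul_cast {σ : Type*} {q : ℚ} (hq : q ≠ 0) :
    (C q⁻¹ : MvPolynomial σ ℚ) * C q = 1 := by
  rw [← C_mul, inv_mul_cancel₀ hq, C_1]

lemma C_half_mul_two : C (1 / 2 : ℚ) * (2 : MvPolynomial (Fin 3) ℚ) = 1 := by
  rw [← C_1, ← map_ofNat (C : ℚ →+* _) 2, ← C_mul]
  norm_num

/-- The coefficients of the generating series `(∑ cₙ xⁿ) / (1 - β x²)`. -/
noncomputable def eseqNat : ℕ → MvPolynomial (Fin 3) ℚ
  | 0 => 1
  | 1 => α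
  | 2 => C (1 / 2 : ℚ) * α ^ 2 + β
  | (n + 3) => C (((n : ℚ) + 3)⁻¹) *
      (α * eseqNat (n + 2) + C ((n : ℚ) + 3) * β * eseqNat (n + 1) + 2 * γ * eseqNat n)

/-- The extension by zero of `eseqNat` to integer indices. -/
noncomputable def eseq : ℤ → MvPolynomial (Fin 3) ℚ
  | .ofNat n => eseqNat n
  | .negSucc _ => 0

lemma eseq_of_neg {n : ℤ} (hn : n < 0) : eseq n = 0 := by
  obtain ⟨k, rfl⟩ := Int.eq_negSucc_of_lt_zero hn
  rfl

lemma eseq_zero : eseq 0 = 1 := by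
  change eseqNat 0 = 1
  rw [eseqNat]

lemma eseq_one : eseq 1 = α := by
  change eseqNat 1 = α
  rw [eseqNat]

lemma eseq_rec (n : ℤ) :
    (n : MvPolynomial (Fin 3) ℚ) * eseq n =
      α * eseq (n - 1) + n * β * eseq (n - 2) + 2 * γ * eseq (n - 3) := by
  rcases lt_or_ge n 0 with hn | hn
  · simp [eseq_of_neg hn, eseq_of_neg (show n - 1 < 0 by lia),
      eseq_of_neg (show n - 2 < 0 by lia), eseq_of_neg (show n - 3 < 0 by lia)]
  lift n to ℕ using hn
  match n with
  | 0 => simp [eseq_of_neg]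
  | 1 => simp [eseq_of_neg, eseq_zero, eseq_one]
  | 2 =>
    have h : eseq 2 = C (1 / 2 : ℚ) * α ^ 2 + β := by
      change eseqNat 2 = _
      rw [eseqNat]
    simp only [Nat.cast_ofNat, Int.cast_ofNat, h, show (2 : ℤ) - 1 = 1 by rfl, eseq_one,
      show (2 : ℤ) - 2 = 0 by rfl, eseq_zero, eseq_of_neg (show (2 : ℤ) - 3 < 0 by lia)]
    linear_combination α ^ 2 * C_half_mul_two
  | k + 3 =>
    have h : eseq ((k + 3 : ℕ) : ℤ) = C (((k : ℚ) + 3)⁻¹) *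
        (α * eseq (k + 2 : ℕ) + C ((k : ℚ) + 3) * β * eseq (k + 1 : ℕ) + 2 * γ * eseq k) := by
      change eseqNat (k + 3) = _
      rw [eseqNat]
      rfl
    have hk := C_inv_mul_cast (σ := Fin 3) (show (k : ℚ) + 3 ≠ 0 by positivity)
    rw [show (((k + 3 : ℕ) : ℤ) - 1) = (k + 2 : ℕ) by lia,
      show (((k + 3 : ℕ) : ℤ) - 2) = (k + 1 : ℕ) by lia,
      show (((k + 3 : ℕ) : ℤ) - 3) = k by lia, h]
    rw [show (((k + 3 : ℕ) : ℤ) : MvPolynomial (Fin 3) ℚ) = C ((k : ℚ) + 3) by simp [map_ofNat]]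
    linear_combination (α * eseq (k + 2 : ℕ) + C ((k : ℚ) + 3) * β * eseq (k + 1 : ℕ)
      + 2 * γ * eseq k) * hk

lemma cseq_eq (n : ℕ) : cseq n = eseq n - β * eseq (n - 2) := by
  induction n using Nat.strong_induction_on with
  | _ n ih =>
  match n with
  | 0 => simp [cseq, eseq_zero, eseq_of_neg]
  | 1 => simp [cseq, eseq_one, eseq_of_neg]
  | 2 =>
    have h : eseq 2 = C (1 / 2 : ℚ) * α ^ 2 + β := by
      change eseqNat 2 = _
      rw [eseqNat]
    simp [cseq, h, eseq_zero]
  | k + 3 =>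
    have hk := C_inv_mul_cast (σ := Fin 3) (show (k : ℚ) + 3 ≠ 0 by positivity)
    have h0 := ih k (by lia)
    have h1 := ih (k + 1) (by lia)
    have h2 := ih (k + 2) (by lia)
    have r1 := eseq_rec (k + 1)
    have r3 := eseq_rec (k + 3)
    rw [show (((k + 1 : ℕ) : ℤ) - 2) = k - 1 by lia] at h1
    rw [show (((k + 2 : ℕ) : ℤ) - 2) = k by lia] at h2
    rw [show (k : ℤ) + 1 - 2 = k - 1 by lia, show (k : ℤ) + 1 - 3 = k - 2 by lia,
      add_sub_cancel_right] at r1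
    rw [show (k : ℤ) + 3 - 1 = k + 2 by lia, show (k : ℤ) + 3 - 2 = k + 1 by lia,
      add_sub_cancel_right] at r3
    rw [show (((k + 3 : ℕ) : ℤ) - 2) = k + 1 by lia]
    push_cast at h0 h1 h2 r1 r3 ⊢
    rw [cseq, h0, h1, h2]
    have e1 : (C ((k : ℚ) + 1) : MvPolynomial (Fin 3) ℚ) = k + 1 := by simp
    have e3 : (C ((k : ℚ) + 3) : MvPolynomial (Fin 3) ℚ) = k + 3 := by simp [map_ofNat]
    rw [e3] at hk
    rw [e1]
    linear_combination (eseq (k + 3) - β * eseq (k + 1)) * hk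
      - C ((k : ℚ) + 3)⁻¹ * (r3 - β * r1)

lemma xiPoly_mul_eseq (n : ℤ) :
    xiPoly * eseq n = (n + 3) * (eseq (n + 3) - β * eseq (n + 1))
      - α * (eseq (n + 2) - β * eseq n) := by
  have h := eseq_rec (n + 3)
  rw [show n + 3 - 1 = n + 2 by lia, show n + 3 - 2 = n + 1 by lia, add_sub_cancel_right] at h
  push_cast at h
  rw [xiPoly]
  linear_combination -h

/-- A two-parameter family extending `eseq`; its member of indices `n + 1` and `p` is homogeneous
for the grading and lies in the ideal `(e_{p+n}, e_{p+n+1}, e_{p+n+2})`. -/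
noncomputable def relPoly : ℕ → ℤ → MvPolynomial (Fin 3) ℚ
  | 0, _ => 0
  | 1, p => eseq p
  | (n + 2), p => C ((((n : ℚ) + 1) * (n + 2))⁻¹) *
      (((p + n + 2 : ℤ) : MvPolynomial (Fin 3) ℚ) * β * relPoly (n + 1) p +
        2 * γ * relPoly (n + 1) (p - 1))

lemma relPoly_zero (p : ℤ) : relPoly 0 p = 0 := by rw [relPoly]

lemma relPoly_one (p : ℤ) : relPoly 1 p = eseq p := by rw [relPoly]

lemma relPoly_succ (n : ℕ) (p : ℤ) :
    (n : MvPolynomial (Fin 3) ℚ) * (n + 1) * relPoly (n + 1) p =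
      (p + n + 1) * β * relPoly n p + 2 * γ * relPoly n (p - 1) := by
  match n with
  | 0 => simp [relPoly]
  | n + 1 =>
    have h := C_inv_mul_cast (σ := Fin 3) (show ((n : ℚ) + 1) * (n + 2) ≠ 0 by positivity)
    have e : (C (((n : ℚ) + 1) * (n + 2)) : MvPolynomial (Fin 3) ℚ) = (n + 1) * (n + 2) := by
      simp [map_ofNat]
    rw [e] at h
    rw [relPoly]
    push_cast
    linear_combination ((p + n + 2) * β * relPoly (n + 1) p
      + 2 * γ * relPoly (n + 1) (p - 1)) * h

lemma relPoly_of_neg (n : ℕ) {p : ℤ} (hp : p < 0) : relPoly n p = 0 := by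
  induction n using Nat.strong_induction_on generalizing p with
  | _ n ih =>
  match n with
  | 0 => rw [relPoly]
  | 1 => rw [relPoly_one, eseq_of_neg hp]
  | n + 2 => rw [relPoly, ih (n + 1) (by lia) hp, ih (n + 1) (by lia) (by lia)]; simp

lemma relPoly_three_term (n : ℕ) (p : ℤ) :
    ((n : MvPolynomial (Fin 3) ℚ) + 1) * (n + 2) * relPoly (n + 2) p =
      (p + 2 - n) * relPoly (n + 1) (p + 2) + β * relPoly n (p + 2)
        - α * relPoly (n + 1) (p + 1) := by
  induction n generalizing p with
  | zero =>
    have h := relPoly_succ 1 p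
    have h2 := eseq_rec (p + 2)
    rw [show p + 2 - 1 = p + 1 by lia, show p + 2 - 3 = p - 1 by lia, add_sub_cancel_right] at h2
    simp only [zero_add, relPoly_one, relPoly_zero] at h ⊢
    push_cast at *
    linear_combination h - h2
  | succ n ih =>
    have b0 := relPoly_succ (n + 2) p
    have b1 := relPoly_succ (n + 1) (p + 2)
    have b2 := relPoly_succ (n + 1) (p + 1)
    have b3 := relPoly_succ n (p + 2)
    have a1 := ih p
    have a2 := ih (p - 1)
    rw [show p + 2 - 1 = p + 1 by lia] at b1 b3
    rw [show p + 1 - 1 = p by lia] at b2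
    rw [show p - 1 + 2 = p + 1 by lia, show p - 1 + 1 = p by lia] at a2
    have hn : ((n : MvPolynomial (Fin 3) ℚ) + 1) * (n + 2) ≠ 0 := by
      exact_mod_cast (show ((n + 1) * (n + 2) : ℕ) ≠ 0 by positivity)
    refine mul_left_cancel₀ hn ?_
    push_cast at *
    linear_combination (n + 1 : MvPolynomial (Fin 3) ℚ) * (n + 2) * b0
      - (p + 1 - n) * b1 + α * b2 - β * b3 + (p + n + 3) * β * a1 + 2 * γ * a2

/-- The ideal `(e_s, e_{s+1}, e_{s+2})`. -/
noncomputable def eIdeal (s : ℕ) : Ideal (MvPolynomial (Fin 3) ℚ) :=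
  Ideal.span {eseq s, eseq (s + 1), eseq (s + 2)}

lemma natCast_mul_mem_iff {σ : Type*} {I : Ideal (MvPolynomial σ ℚ)} {n : ℕ} (hn : n ≠ 0)
    {f : MvPolynomial σ ℚ} : (n : MvPolynomial σ ℚ) * f ∈ I ↔ f ∈ I := by
  refine ⟨fun h => ?_, I.mul_mem_left _⟩
  have := I.mul_mem_left (C (n : ℚ)⁻¹) h
  rwa [← mul_assoc, ← map_natCast (C : ℚ →+* _), C_inv_mul_cast (by positivity), one_mul] at this

lemma eseq_mem_eIdeal {s : ℕ} {n : ℤ} (h : s ≤ n) : eseq n ∈ eIdeal s := by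
  obtain ⟨k, rfl⟩ := Int.le.dest h
  induction k using Nat.strong_induction_on with
  | _ k ih =>
  match k with
  | 0 => exact Ideal.subset_span (by simp)
  | 1 => exact Ideal.subset_span (by simp)
  | 2 => exact Ideal.subset_span (by simp)
  | k + 3 =>
    rw [← natCast_mul_mem_iff (show s + k + 3 ≠ 0 by lia)]
    have hr := eseq_rec (s + (k + 3 : ℕ))
    rw [show (s : ℤ) + (k + 3 : ℕ) - 1 = s + (k + 2 : ℕ) by lia,
      show (s : ℤ) + (k + 3 : ℕ) - 2 = s + (k + 1 : ℕ) by lia,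
      show (s : ℤ) + (k + 3 : ℕ) - 3 = s + k by lia] at hr
    have hc : ((s + k + 3 : ℕ) : MvPolynomial (Fin 3) ℚ) = ((s + (k + 3 : ℕ) : ℤ) : _) := by
      push_cast
      ring
    rw [hc, hr]
    exact add_mem (add_mem (Ideal.mul_mem_left _ _ (ih _ (by lia) (by lia)))
      (Ideal.mul_mem_left _ _ (ih _ (by lia) (by lia))))
      (Ideal.mul_mem_left _ _ (ih _ (by lia) (by lia)))

lemma relPoly_mem_eIdeal {s : ℕ} (n : ℕ) {p : ℤ} (h : s ≤ p + n) :
    relPoly (n + 1) p ∈ eIdeal s := by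
  induction n using Nat.strong_induction_on generalizing p with
  | _ n ih =>
  match n with
  | 0 => rw [relPoly_one]; exact eseq_mem_eIdeal (by lia)
  | n + 1 =>
    rw [← natCast_mul_mem_iff (show (n + 1) * (n + 2) ≠ 0 by positivity)]
    have h1 : relPoly (n + 1) (p + 2) ∈ eIdeal s := ih n (by lia) (by lia)
    have h2 : relPoly (n + 1) (p + 1) ∈ eIdeal s := ih n (by lia) (by lia)
    have h3 : relPoly n (p + 2) ∈ eIdeal s := by
      match n with
      | 0 => simp [relPoly_zero]
      | n + 1 => exact ih n (by lia) (by lia)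
    push_cast
    rw [relPoly_three_term n p]
    exact sub_mem (add_mem (Ideal.mul_mem_left _ _ h1) (Ideal.mul_mem_left _ _ h3))
      (Ideal.mul_mem_left _ _ h2)

lemma γ_mul_mem_eIdeal {s : ℕ} {f : MvPolynomial (Fin 3) ℚ} (hf : f ∈ eIdeal s) :
    γ * f ∈ eIdeal (s + 1) := by
  refine Submodule.span_induction (p := fun f _ => γ * f ∈ eIdeal (s + 1)) ?_ (by simp)
    (fun x y _ _ hx hy => by rw [mul_add]; exact add_mem hx hy)
    (fun a x _ hx => by rw [smul_eq_mul, mul_left_comm]; exact Ideal.mul_mem_left _ _ hx) hf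
  rintro _ (rfl | rfl | rfl)
  · rw [← natCast_mul_mem_iff two_ne_zero]
    have h := eseq_rec (s + 3)
    rw [show (s : ℤ) + 3 - 1 = s + 2 by lia, show (s : ℤ) + 3 - 2 = s + 1 by lia,
      add_sub_cancel_right] at h
    have e : ((2 : ℕ) : MvPolynomial (Fin 3) ℚ) * (γ * eseq s) = (s + 3 : ℤ) * eseq (s + 3)
        - α * eseq (s + 2) - (s + 3 : ℤ) * β * eseq (s + 1) := by
      push_cast at *
      linear_combination -h
    rw [e]
    exact sub_mem (sub_mem (Ideal.mul_mem_left _ _ (eseq_mem_eIdeal (by lia)))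
      (Ideal.mul_mem_left _ _ (eseq_mem_eIdeal (by lia))))
      (Ideal.mul_mem_left _ _ (eseq_mem_eIdeal (by lia)))
  · exact Ideal.mul_mem_left _ _ (eseq_mem_eIdeal (by lia))
  · exact Ideal.mul_mem_left _ _ (eseq_mem_eIdeal (by lia))

lemma β_pow_mem_eIdeal {n s : ℕ} (h : s ≤ n) : β ^ n ∈ eIdeal s := by
  suffices H : relPoly (n + 1) 0 ∈ eIdeal s → β ^ n ∈ eIdeal s from
    H (relPoly_mem_eIdeal n (by lia))
  have key : ∀ n : ℕ, (n.factorial : MvPolynomial (Fin 3) ℚ) * relPoly (n + 1) 0 = β ^ n := by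
    intro n
    induction n with
    | zero => simp [relPoly_one, eseq_zero]
    | succ n ih =>
      have h := relPoly_succ (n + 1) 0
      rw [relPoly_of_neg _ (show (0 : ℤ) - 1 < 0 by lia)] at h
      have hn : (n : MvPolynomial (Fin 3) ℚ) + 2 ≠ 0 := by
        exact_mod_cast (show (n + 2 : ℕ) ≠ 0 by positivity)
      refine mul_left_cancel₀ hn ?_
      rw [Nat.factorial_succ]
      push_cast at *
      linear_combination (n.factorial : MvPolynomial (Fin 3) ℚ) * h + (n + 2) * β * ih
  intro h
  rw [← key]
  exact Ideal.mul_mem_left _ _ h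

lemma β_pow_mul_γ_pow_mem_eIdeal {s j t : ℕ} (h : s ≤ j + t) : β ^ j * γ ^ t ∈ eIdeal s := by
  induction t generalizing s with
  | zero => simpa using β_pow_mem_eIdeal (by lia)
  | succ t ih =>
    match s with
    | 0 =>
      have h : (1 : MvPolynomial (Fin 3) ℚ) ∈ eIdeal 0 := by
        simpa [eseq_zero] using eseq_mem_eIdeal (le_refl ((0 : ℕ) : ℤ))
      simpa using Ideal.mul_mem_left _ (β ^ j * γ ^ (t + 1)) h
    | s + 1 =>
      rw [pow_succ', mul_left_comm]
      exact γ_mul_mem_eIdeal (ih (by lia))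

lemma β_pow_mul_γ_pow_mul_xiPoly_pow_mem_eIdeal {s j t k : ℕ} (h : s ≤ j + t + k) :
    β ^ j * γ ^ t * xiPoly ^ k ∈ eIdeal s := by
  induction k generalizing j t with
  | zero => simpa using β_pow_mul_γ_pow_mem_eIdeal (by lia)
  | succ k ih =>
    have e : β ^ j * γ ^ t * xiPoly ^ (k + 1) = α * (β ^ (j + 1) * γ ^ t * xiPoly ^ k)
        + 2 * (β ^ j * γ ^ (t + 1) * xiPoly ^ k) := by
      rw [pow_succ xiPoly, xiPoly]
      ring
    rw [e]
    exact add_mem (Ideal.mul_mem_left _ _ (ih (by lia))) (Ideal.mul_mem_left _ _ (ih (by lia)))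

/-- The span of the monomials `α^i β^j ξ^k` with `j + k > n`, or with `j + k = n` and `k < K`. -/
noncomputable def lowerSpan (n K : ℕ) : Submodule ℚ (MvPolynomial (Fin 3) ℚ) :=
  Submodule.span ℚ {f | ∃ i j k : ℕ, (n < j + k ∨ j + k = n ∧ k < K) ∧
    f = α ^ i * β ^ j * xiPoly ^ k}

lemma monomial_mem_lowerSpan {n K i j k : ℕ} (h : n < j + k ∨ j + k = n ∧ k < K) :
    α ^ i * β ^ j * xiPoly ^ k ∈ lowerSpan n K :=
  Submodule.subset_span ⟨i, j, k, h, rfl⟩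

lemma lowerSpan_mono {n n' K K' : ℕ} (h : n' < n ∨ n' = n ∧ K ≤ K') :
    lowerSpan n K ≤ lowerSpan n' K' := by
  refine Submodule.span_le.2 ?_
  rintro _ ⟨i, j, k, hk, rfl⟩
  exact monomial_mem_lowerSpan (by lia)

lemma monomial_mul_mem_lowerSpan {n K : ℕ} {f : MvPolynomial (Fin 3) ℚ} (hf : f ∈ lowerSpan n K)
    (a b c : ℕ) : α ^ a * β ^ b * xiPoly ^ c * f ∈ lowerSpan (n + b + c) (K + c) := by
  refine Submodule.span_induction
    (p := fun f _ => α ^ a * β ^ b * xiPoly ^ c * f ∈ lowerSpan (n + b + c) (K + c))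
    ?_ (by simp) (fun x y _ _ hx hy => by rw [mul_add]; exact add_mem hx hy)
    (fun q x _ hx => by rw [mul_smul_comm]; exact Submodule.smul_mem _ _ hx) hf
  rintro _ ⟨i, j, k, hk, rfl⟩
  rw [show α ^ a * β ^ b * xiPoly ^ c * (α ^ i * β ^ j * xiPoly ^ k) =
    α ^ (a + i) * β ^ (b + j) * xiPoly ^ (c + k) by ring]
  exact monomial_mem_lowerSpan (by lia)

lemma α_mul_mem_lowerSpan {n K : ℕ} {f : MvPolynomial (Fin 3) ℚ} (hf : f ∈ lowerSpan n K) :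
    α * f ∈ lowerSpan n K := by
  simpa using monomial_mul_mem_lowerSpan hf 1 0 0

lemma β_mul_mem_lowerSpan {n K : ℕ} {f : MvPolynomial (Fin 3) ℚ} (hf : f ∈ lowerSpan n K) :
    β * f ∈ lowerSpan (n + 1) K := by
  simpa using monomial_mul_mem_lowerSpan hf 0 1 0

lemma xiPoly_mul_mem_lowerSpan {n K : ℕ} {f : MvPolynomial (Fin 3) ℚ} (hf : f ∈ lowerSpan n K) :
    xiPoly * f ∈ lowerSpan (n + 1) (K + 1) := by
  simpa using monomial_mul_mem_lowerSpan hf 0 0 1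

lemma C_mul_mem_lowerSpan {n K : ℕ} {f : MvPolynomial (Fin 3) ℚ} (hf : f ∈ lowerSpan n K)
    (q : ℚ) : C q * f ∈ lowerSpan n K := by
  rw [C_mul']
  exact Submodule.smul_mem _ _ hf

lemma γ_eq_mul_xiPoly_sub : γ = C (1 / 2 : ℚ) * (xiPoly - α * β) := by
  rw [xiPoly]
  linear_combination -γ * C_half_mul_two

lemma mem_lowerSpan_zero_one (f : MvPolynomial (Fin 3) ℚ) : f ∈ lowerSpan 0 1 := by
  induction f using MvPolynomial.induction_on with
  | C a =>
    have h : α ^ 0 * β ^ 0 * xiPoly ^ 0 ∈ lowerSpan 0 1 := monomial_mem_lowerSpan (by lia)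
    simpa using C_mul_mem_lowerSpan h a
  | add p q hp hq => exact add_mem hp hq
  | mul_X p i hp =>
    have hα := α_mul_mem_lowerSpan hp
    have hβ : β * p ∈ lowerSpan 0 1 := lowerSpan_mono (by lia) (β_mul_mem_lowerSpan hp)
    have hξ : xiPoly * p ∈ lowerSpan 0 1 := lowerSpan_mono (by lia) (xiPoly_mul_mem_lowerSpan hp)
    rw [mul_comm]
    match i with
    | 0 => exact hα
    | 1 => exact hβ
    | 2 =>
      rw [γ_eq_mul_xiPoly_sub, mul_assoc, sub_mul, mul_assoc]
      exact C_mul_mem_lowerSpan (sub_mem hξ (α_mul_mem_lowerSpan hβ)) _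

lemma eseq_leading (p : ℕ) : ∃ u : ℚ, 0 < u ∧ eseq p - C u * α ^ p ∈ lowerSpan 0 0 := by
  induction p with
  | zero => exact ⟨1, one_pos, by simp [eseq_zero]⟩
  | succ p ih =>
    obtain ⟨u, hu, h⟩ := ih
    refine ⟨((p : ℚ) + 1)⁻¹ * u, by positivity, ?_⟩
    have hr := eseq_rec (p + 1)
    rw [add_sub_cancel_right] at hr
    have hp := C_inv_mul_cast (σ := Fin 3) (show (p : ℚ) + 1 ≠ 0 by positivity)
    have hβ (f) : β * f ∈ lowerSpan 0 0 :=
      lowerSpan_mono (by lia) (β_mul_mem_lowerSpan (mem_lowerSpan_zero_one f))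
    have hξ (f) : xiPoly * f ∈ lowerSpan 0 0 :=
      lowerSpan_mono (by lia) (xiPoly_mul_mem_lowerSpan (mem_lowerSpan_zero_one f))
    have e : eseq (p + 1 : ℕ) - C (((p : ℚ) + 1)⁻¹ * u) * α ^ (p + 1) =
        C ((p : ℚ) + 1)⁻¹ * (α * (eseq p - C u * α ^ p) + C ((p : ℚ) + 1) * (β * eseq (p + 1 - 2))
          + (xiPoly * eseq (p + 1 - 3) - α * (β * eseq (p + 1 - 3)))) := by
      have ec : (C ((p : ℚ) + 1) : MvPolynomial (Fin 3) ℚ) = p + 1 := by simp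
      rw [ec] at hp
      rw [C_mul, xiPoly, ec]
      push_cast at hr ⊢
      linear_combination C ((p : ℚ) + 1)⁻¹ * hr - eseq (p + 1) * hp
    rw [e]
    exact C_mul_mem_lowerSpan (add_mem (add_mem (α_mul_mem_lowerSpan h)
      (C_mul_mem_lowerSpan (hβ _) _)) (sub_mem (hξ _) (α_mul_mem_lowerSpan (hβ _)))) _

lemma mem_lowerSpan_of_leading {n p : ℕ} {f : MvPolynomial (Fin 3) ℚ} {u : ℚ}
    (h : f - C u * (α ^ (p - n) * β ^ (n - p) * xiPoly ^ min p n) ∈ lowerSpan n (min p n)) :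
    f ∈ lowerSpan n (min p n + 1) := by
  rw [← sub_add_cancel f (C u * (α ^ (p - n) * β ^ (n - p) * xiPoly ^ min p n))]
  exact add_mem (lowerSpan_mono (by lia) h)
    (C_mul_mem_lowerSpan (monomial_mem_lowerSpan (by lia)) _)

lemma relPoly_add_two (n p : ℕ) :
    relPoly (n + 2) p = C (((n : ℚ) + 1) * (n + 2))⁻¹ *
      (C ((p : ℚ) + n + 2) * (β * relPoly (n + 1) p) +
        (xiPoly * relPoly (n + 1) (p - 1) - α * (β * relPoly (n + 1) (p - 1)))) := by
  rw [relPoly, xiPoly]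
  simp only [map_add, map_natCast, map_ofNat]
  push_cast
  ring

lemma relPoly_leading (n p : ℕ) : ∃ u : ℚ, 0 < u ∧
    relPoly (n + 1) p - C u * (α ^ (p - n) * β ^ (n - p) * xiPoly ^ min p n) ∈
      lowerSpan n (min p n) := by
  induction n generalizing p with
  | zero => simpa [relPoly_one] using eseq_leading p
  | succ n ih =>
    have hr := relPoly_add_two n p
    obtain ⟨w, hw, hwN⟩ : ∃ w : ℚ, 0 < w ∧ (((n : ℚ) + 1) * (n + 2))⁻¹ = w :=
      ⟨_, by positivity, rfl⟩
    rw [hwN] at hr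
    rw [show n + 1 + 1 = n + 2 by rfl, hr]
    clear hr hwN
    match p with
    | 0 =>
      obtain ⟨u, hu, h⟩ := ih 0
      rw [relPoly_of_neg _ (show ((0 : ℕ) : ℤ) - 1 < 0 by lia)]
      refine ⟨w * ((0 : ℕ) + n + 2) * u, by positivity, ?_⟩
      have h2 := C_mul_mem_lowerSpan (β_mul_mem_lowerSpan h) (w * ((0 : ℕ) + n + 2))
      refine lowerSpan_mono (n := n + 1) (K := min 0 n) (by lia) ?_
      convert! h2 using 1
      simp only [Nat.zero_sub, Nat.sub_zero, Nat.zero_min, C_mul]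
      ring
    | q + 1 =>
      obtain ⟨u, hu, h⟩ := ih (q + 1)
      obtain ⟨v, hv, h'⟩ := ih q
      have hm := mem_lowerSpan_of_leading h
      have hm' := mem_lowerSpan_of_leading h'
      rw [show (((q + 1 : ℕ) : ℤ) - 1) = q by lia]
      have hαβ : α * (β * relPoly (n + 1) q) ∈ lowerSpan (n + 1) (min (q + 1) (n + 1)) :=
        α_mul_mem_lowerSpan (lowerSpan_mono (by lia) (β_mul_mem_lowerSpan hm'))
      have hξ := lowerSpan_mono (n' := n + 1) (K' := min (q + 1) (n + 1)) (by lia)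
        (xiPoly_mul_mem_lowerSpan h')
      rcases le_or_gt n q with hnq | hnq
      · refine ⟨w * v, by positivity, ?_⟩
        have hβ : β * relPoly (n + 1) (q + 1 : ℕ) ∈ lowerSpan (n + 1) (min (q + 1) (n + 1)) :=
          lowerSpan_mono (by lia) (β_mul_mem_lowerSpan hm)
        have h2 := C_mul_mem_lowerSpan (add_mem (C_mul_mem_lowerSpan hβ ((q + 1 : ℕ) + n + 2))
          (sub_mem hξ hαβ)) w
        convert! h2 using 1
        rw [show n + 1 - (q + 1) = 0 by lia, show n - q = 0 by lia,
          show q + 1 - (n + 1) = q - n by lia, min_eq_right (show n + 1 ≤ q + 1 by lia),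
          min_eq_right hnq, C_mul]
        ring
      · refine ⟨w * (((q + 1 : ℕ) + n + 2) * u + v), by positivity, ?_⟩
        have hβ := lowerSpan_mono (n' := n + 1) (K' := min (q + 1) (n + 1)) (by lia)
          (β_mul_mem_lowerSpan h)
        have h2 := C_mul_mem_lowerSpan (add_mem (C_mul_mem_lowerSpan hβ ((q + 1 : ℕ) + n + 2))
          (sub_mem hξ hαβ)) w
        convert! h2 using 1
        rw [show n + 1 - (q + 1) = n - (q + 1) + 1 by lia, show n - q = n - (q + 1) + 1 by lia,
          show q - n = 0 by lia, show q + 1 - (n + 1) = 0 by lia, show q + 1 - n = 0 by lia,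
          min_eq_left (show q + 1 ≤ n + 1 by lia), min_eq_left (show q + 1 ≤ n by lia),
          min_eq_left (show q ≤ n by lia)]
        simp only [C_mul, C_add]
        ring

/-- The exponents `(i, j, k)` with `i + 2k < s` and `j + 2k < s`. -/
def boxExponents (s : ℕ) : Set (ℕ × ℕ × ℕ) :=
  {t | t.1 + 2 * t.2.2 < s ∧ t.2.1 + 2 * t.2.2 < s}

lemma lowerSpan_le {s : ℕ} {W : Submodule ℚ (MvPolynomial (Fin 3) ℚ)}
    (hJ : ∀ f ∈ eIdeal s, f ∈ W)
    (hT : ∀ i j k : ℕ, i + 2 * k < s → j + 2 * k < s → α ^ i * β ^ j * xiPoly ^ k ∈ W)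
    (n K : ℕ) : lowerSpan n K ≤ W := by
  suffices H : ∀ d n K, s ≤ n + d → lowerSpan n K ≤ W from H s n K (by lia)
  clear n K
  intro d
  induction d with
  | zero =>
    intro n K hn
    refine Submodule.span_le.2 ?_
    rintro _ ⟨i, j, k, hk, rfl⟩
    rw [mul_assoc]
    refine hJ _ (Ideal.mul_mem_left _ _ ?_)
    simpa using β_pow_mul_γ_pow_mul_xiPoly_pow_mem_eIdeal (t := 0) (show s ≤ j + 0 + k by lia)
  | succ d ihd =>
    intro n K hn
    induction K with
    | zero =>
      refine le_trans (Submodule.span_le.2 ?_) (ihd (n + 1) (n + 2) (by lia))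
      rintro _ ⟨i, j, k, hk, rfl⟩
      exact monomial_mem_lowerSpan (by lia)
    | succ K ihK =>
      refine Submodule.span_le.2 ?_
      rintro _ ⟨i, j, k, hk, rfl⟩
      by_cases hlow : n < j + k ∨ j + k = n ∧ k < K
      · exact ihK (monomial_mem_lowerSpan hlow)
      obtain ⟨rfl, rfl⟩ : j + k = n ∧ k = K := by lia
      have key : ∀ u : ℚ, 0 < u → ∀ f ∈ eIdeal s,
          f - C u * (α ^ i * β ^ j * xiPoly ^ k) ∈ lowerSpan (j + k) k →
          α ^ i * β ^ j * xiPoly ^ k ∈ W := by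
        intro u hu f hf h
        have h2 := W.sub_mem (hJ f hf) (ihK h)
        rw [sub_sub_cancel, C_mul'] at h2
        exact (W.smul_mem_iff hu.ne').1 h2
      rcases lt_or_ge (i + 2 * k) s with hi | hi
      · rcases lt_or_ge (j + 2 * k) s with hj | hj
        · exact hT i j k hi hj
        · obtain ⟨u, hu, h⟩ := relPoly_leading (j + k) k
          refine key u hu (α ^ i * relPoly (j + k + 1) k)
            (Ideal.mul_mem_left _ _ (relPoly_mem_eIdeal _ (by lia))) ?_
          rw [show k - (j + k) = 0 by lia, show j + k - k = j by lia,
            min_eq_left (show k ≤ j + k by lia)] at h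
          convert! monomial_mul_mem_lowerSpan h i 0 0 using 1
          ring
      · obtain ⟨u, hu, h⟩ := relPoly_leading k (i + k)
        refine key u hu (β ^ j * relPoly (k + 1) (i + k : ℕ))
          (Ideal.mul_mem_left _ _ (relPoly_mem_eIdeal _ (by lia))) ?_
        rw [show k - (i + k) = 0 by lia, show i + k - k = i by lia,
          min_eq_right (show k ≤ i + k by lia)] at h
        rw [add_comm j k]
        convert! monomial_mul_mem_lowerSpan h 0 j 0 using 1
        ring

lemma sub_aeval_mem {σ : Type*} {I : Ideal (MvPolynomial σ ℚ)} {ψ : σ → MvPolynomial σ ℚ}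
    (h : ∀ i, X i - ψ i ∈ I) (f : MvPolynomial σ ℚ) : f - aeval ψ f ∈ I := by
  have e : (Ideal.Quotient.mkₐ ℚ I).comp (aeval ψ) = Ideal.Quotient.mkₐ ℚ I := by
    ext i
    simpa using (Ideal.Quotient.eq.2 (h i)).symm
  rw [← Ideal.Quotient.eq]
  exact (DFunLike.congr_fun e f).symm

lemma eseq_succ (n : ℕ) : ∃ g, eseq (n + 1) =
    C ((n : ℚ) + 1)⁻¹ * α * eseq n + β * eseq (n - 1) + γ * g := by
  have hr := eseq_rec (n + 1)
  rw [add_sub_cancel_right, show (n : ℤ) + 1 - 2 = n - 1 by lia,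
    show (n : ℤ) + 1 - 3 = n - 2 by lia] at hr
  have hn := C_inv_mul_cast (σ := Fin 3) (show (n : ℚ) + 1 ≠ 0 by positivity)
  refine ⟨C ((n : ℚ) + 1)⁻¹ * 2 * eseq (n - 2), ?_⟩
  rw [map_add, map_natCast, C_1] at hn
  push_cast at hr
  linear_combination C ((n : ℚ) + 1)⁻¹ * hr - (eseq (n + 1) - β * eseq (n - 1)) * hn

lemma eseq_add_two (n : ℕ) : ∃ r g, eseq (n + 2) =
    r * eseq (n + 1) + β * eseq n + γ * g := by
  obtain ⟨g, h⟩ := eseq_succ (n + 1)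
  push_cast at h
  rw [add_sub_cancel_right, show (n : ℤ) + 1 + 1 = n + 2 by lia] at h
  exact ⟨_, g, h⟩

lemma eseq_eq_α_pow (n : ℕ) : ∃ u : ℚ, u ≠ 0 ∧ ∃ g h, eseq n = C u * α ^ n + β * g + γ * h := by
  induction n with
  | zero => exact ⟨1, one_ne_zero, 0, 0, by simp [eseq_zero]⟩
  | succ n ih =>
    obtain ⟨u, hu, g, h, e⟩ := ih
    obtain ⟨g', e'⟩ := eseq_succ n
    refine ⟨((n : ℚ) + 1)⁻¹ * u, by positivity, C ((n : ℚ) + 1)⁻¹ * α * g + eseq (n - 1),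
      C ((n : ℚ) + 1)⁻¹ * α * h + g', ?_⟩
    push_cast
    rw [e', e, C_mul]
    ring

lemma exists_of_α_pow_mul {n : ℕ} {b g h : MvPolynomial (Fin 3) ℚ} {u : ℚ} (hu : u ≠ 0)
    (e : b * (C u * α ^ n) = β * g + γ * h) : ∃ b₁ b₂, b = β * b₁ + γ * b₂ := by
  have hz : aeval ![α, 0, 0] b = 0 := by
    have := congrArg (aeval ![α, 0, 0] : _ →ₐ[ℚ] MvPolynomial (Fin 3) ℚ) e
    simpa [hu] using this
  have hβ : β ∈ Ideal.span {β, γ} := Ideal.subset_span (by simp)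
  have hγ : γ ∈ Ideal.span {β, γ} := Ideal.subset_span (by simp)
  have := sub_aeval_mem (I := Ideal.span {β, γ}) (ψ := ![α, 0, 0])
    (fun i => by fin_cases i <;> simp [hβ, hγ]) b
  rw [hz, sub_zero, Ideal.mem_span_pair] at this
  obtain ⟨b₁, b₂, h⟩ := this
  exact ⟨b₁, b₂, by rw [← h]; ring⟩

lemma γ_dvd_of_dvd_β_mul {f : MvPolynomial (Fin 3) ℚ} (h : γ ∣ β * f) : γ ∣ f := by
  refine (X_prime.dvd_or_dvd h).resolve_left ?_
  simp [X_dvd_X]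

lemma degree_lt_of_X_mul {i : Fin 3} {s : ℕ} {f : MvPolynomial (Fin 3) ℚ}
    (h : ∀ d ∈ (X i * f).support, d.degree < s + 1) : ∀ d ∈ f.support, d.degree < s := by
  intro d hd
  have := h (Finsupp.single i 1 + d) (by simpa [support_X_mul] using hd)
  simp at this
  lia

lemma exists_eq_β_mul_add_γ_mul {s : ℕ} {f : MvPolynomial (Fin 3) ℚ}
    (hf : ∀ d ∈ f.support, d.degree < s + 1) (h0 : ∀ d ∈ f.support, d 1 ≠ 0 ∨ d 2 ≠ 0) :
    ∃ g h, f = β * g + γ * h ∧ ∀ d ∈ g.support, d.degree < s := by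
  have hγ : γ ∣ f.modMonomial (Finsupp.single 1 1) := by
    rw [← Ideal.mem_span_singleton, ← Set.image_singleton, mem_ideal_span_X_image]
    intro d hd
    refine ⟨2, rfl, ?_⟩
    rw [mem_support_iff] at hd
    have h1 : d 1 = 0 := by
      by_contra h1
      exact hd (coeff_modMonomial_of_le _ (by simpa using Nat.one_le_iff_ne_zero.2 h1))
    rw [coeff_modMonomial_of_not_le _ (by simp [h1])] at hd
    exact (h0 d (mem_support_iff.2 hd)).resolve_left (by simp [h1])
  obtain ⟨h, hh⟩ := hγ
  refine ⟨f.divMonomial (Finsupp.single 1 1), h, ?_, fun d hd => ?_⟩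
  · rw [← hh, divMonomial_add_modMonomial_single]
  · have := hf (Finsupp.single 1 1 + d) (by
      simpa [mem_support_iff, coeff_divMonomial] using hd)
    simp at this
    lia

lemma γ_dvd_of_degree_lt {s : ℕ} {f : MvPolynomial (Fin 3) ℚ}
    (hf : ∀ d ∈ f.support, d.degree < s) {a b c : MvPolynomial (Fin 3) ℚ}
    (e : f = γ * a + b * eseq s + c * eseq (s + 1)) : γ ∣ f := by
  induction s generalizing f a b c with
  | zero =>
    have : f = 0 := by
      rw [← support_eq_empty, Finset.eq_empty_iff_forall_notMem]
      exact fun d hd => absurd (hf d hd) (by lia)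
    simp [this]
  | succ s ih =>
    obtain ⟨r, g, er⟩ := eseq_add_two s
    obtain ⟨u, hu, p, q, eu⟩ := eseq_eq_α_pow (s + 1)
    push_cast at e eu
    rw [show (s : ℤ) + 1 + 1 = s + 2 by lia, er] at e
    have h0 : ∀ d ∈ f.support, d 1 ≠ 0 ∨ d 2 ≠ 0 := by
      have : f ∈ Ideal.span ((fun t => monomial t (1 : ℚ)) ''
          {Finsupp.single 0 (s + 1), Finsupp.single 1 1, Finsupp.single (2 : Fin 3) 1}) := by
        have ef : f = (b + c * r) * C u * monomial (Finsupp.single 0 (s + 1)) 1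
            + ((b + c * r) * p + c * eseq s) * monomial (Finsupp.single 1 1) 1
            + ((b + c * r) * q + a + c * g) * monomial (Finsupp.single 2 1) 1 := by
          rw [← X_pow_eq_monomial, ← X, ← X, e]
          linear_combination (b + c * r) * eu
        rw [ef]
        refine add_mem (add_mem ?_ ?_) ?_ <;>
          exact Ideal.mul_mem_left _ _ (Ideal.subset_span ⟨_, by simp, rfl⟩)
      rw [mem_ideal_span_monomial_image] at this
      intro d hd
      obtain ⟨t, ht, htd⟩ := this d hd
      have hdeg := hf d hd
      rw [Finsupp.degree_eq_sum, Fin.sum_univ_three] at hdeg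
      rcases ht with rfl | rfl | rfl <;> rw [Finsupp.single_le_iff] at htd <;> lia
    obtain ⟨h, k, ef, hdeg⟩ := exists_eq_β_mul_add_γ_mul hf h0
    obtain ⟨b₁, b₂, eb⟩ := exists_of_α_pow_mul (n := s + 1) (b := b + c * r)
      (g := h - (b + c * r) * p - c * eseq s) (h := k - a - c * g - (b + c * r) * q) hu (by
        linear_combination ef - e - (b + c * r) * eu)
    obtain ⟨t, ht⟩ : γ ∣ h - b₁ * eseq (s + 1) - c * eseq s := by
      refine γ_dvd_of_dvd_β_mul ⟨a + c * g + b₂ * eseq (s + 1) - k, ?_⟩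
      linear_combination e - ef + eseq (s + 1) * eb
    obtain ⟨h', rfl⟩ := ih hdeg (a := t) (b := c) (c := b₁) (by linear_combination ht)
    exact ⟨β * h' + k, by rw [ef]; ring⟩

lemma exists_syzygy {s : ℕ} {A B : MvPolynomial (Fin 3) ℚ}
    (h : γ ∣ A * eseq s + B * eseq (s + 1)) :
    ∃ h, γ ∣ A - h * eseq (s + 1) ∧ γ ∣ B + h * eseq s := by
  induction s generalizing A B with
  | zero =>
    refine ⟨-B, ?_, by simp [eseq_zero]⟩
    simpa [eseq_zero] using h
  | succ s ih =>
    obtain ⟨r, g, er⟩ := eseq_add_two s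
    obtain ⟨u, hu, p, q, eu⟩ := eseq_eq_α_pow (s + 1)
    obtain ⟨w, hw⟩ := h
    push_cast at *
    rw [show (s : ℤ) + 1 + 1 = s + 2 by lia, er] at *
    obtain ⟨h, ⟨x, hx⟩, ⟨y, hy⟩⟩ := ih (A := β * B) (B := A + r * B)
      ⟨w - B * g, by linear_combination hw⟩
    obtain ⟨h₁, h₂, eh⟩ := exists_of_α_pow_mul (n := s + 1) (b := h)
      (g := B - h * p) (h := - x - h * q) hu (by linear_combination -hx - h * eu)
    obtain ⟨z, hz⟩ : γ ∣ B - h₁ * eseq (s + 1) := by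
      refine γ_dvd_of_dvd_β_mul ⟨x + h₂ * eseq (s + 1), ?_⟩
      linear_combination hx + eseq (s + 1) * eh
    refine ⟨-h₁, ⟨y - r * z - h₂ * eseq s + h₁ * g, ?_⟩, ⟨z, by linear_combination hz⟩⟩
    linear_combination hy - r * hz - eseq s * eh

lemma eq_zero_of_mem_eIdeal {s : ℕ} {f : MvPolynomial (Fin 3) ℚ} (h : f ∈ eIdeal s)
    (hf : ∀ d ∈ f.support, d.degree < s) : f = 0 := by
  induction s generalizing f with
  | zero =>
    rw [← support_eq_empty, Finset.eq_empty_iff_forall_notMem]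
    exact fun d hd => absurd (hf d hd) (by lia)
  | succ s ih =>
    rw [eIdeal, Ideal.mem_span_insert] at h
    obtain ⟨A, z, hz, ef⟩ := h
    obtain ⟨B, D, ez⟩ := Ideal.mem_span_pair.1 hz
    rw [← ez] at ef
    have hr := eseq_rec (s + 3)
    rw [show (s : ℤ) + 3 - 1 = s + 2 by lia, show (s : ℤ) + 3 - 2 = s + 1 by lia,
      add_sub_cancel_right] at hr
    have hs := C_inv_mul_cast (σ := Fin 3) (show (s : ℚ) + 3 ≠ 0 by positivity)
    rw [map_add, map_natCast, map_ofNat] at hs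
    push_cast at *
    rw [show (s : ℤ) + 1 + 1 = s + 2 by lia, show (s : ℤ) + 1 + 2 = s + 3 by lia] at *
    set v : MvPolynomial (Fin 3) ℚ := C ((s : ℚ) + 3)⁻¹
    have ef' : f = γ * (2 * v * D * eseq s) + (A + D * β) * eseq (s + 1)
        + (B + v * D * α) * eseq (s + 2) := by
      linear_combination ef + D * v * hr - D * (eseq (s + 3) - β * eseq (s + 1)) * hs
    obtain ⟨f₁, rfl⟩ := γ_dvd_of_degree_lt (s := s + 1) hf (a := 2 * v * D * eseq s)
      (b := A + D * β) (c := B + v * D * α) (by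
        push_cast
        rwa [show (s : ℤ) + 1 + 1 = s + 2 by lia])
    obtain ⟨h, ⟨x, hx⟩, ⟨y, hy⟩⟩ := exists_syzygy (s := s + 1) (A := A + D * β)
      (B := B + v * D * α) ⟨f₁ - 2 * v * D * eseq s, by
        push_cast
        rw [show (s : ℤ) + 1 + 1 = s + 2 by lia]
        linear_combination -ef'⟩
    push_cast at hx hy
    rw [show (s : ℤ) + 1 + 1 = s + 2 by lia] at hx
    have e1 : f₁ = 2 * v * D * eseq s + x * eseq (s + 1) + y * eseq (s + 2) := by
      refine mul_left_cancel₀ (X_ne_zero (2 : Fin 3)) ?_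
      linear_combination ef' + eseq (s + 1) * hx + eseq (s + 2) * hy
    have : f₁ = 0 := by
      refine ih ?_ (degree_lt_of_X_mul hf)
      rw [e1]
      exact add_mem (add_mem (Ideal.mul_mem_left _ _ (eseq_mem_eIdeal (by lia)))
        (Ideal.mul_mem_left _ _ (eseq_mem_eIdeal (by lia))))
        (Ideal.mul_mem_left _ _ (eseq_mem_eIdeal (by lia)))
    rw [this, mul_zero]

lemma linearIndependent_monomial_mk (s : ℕ) :
    LinearIndependent ℚ (fun d : {d : Fin 3 →₀ ℕ // d.degree < s} =>
      Ideal.Quotient.mk (eIdeal s) (monomial d.1 1)) := by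
  have hi := (basisMonomials (Fin 3) ℚ).linearIndependent.comp
    (Subtype.val : {d : Fin 3 →₀ ℕ // d.degree < s} → _) Subtype.val_injective
  refine hi.map (f := (Ideal.Quotient.mkₐ ℚ (eIdeal s)).toLinearMap) ?_
  rw [Submodule.disjoint_def]
  intro f hf h0
  refine eq_zero_of_mem_eIdeal (Ideal.Quotient.eq_zero_iff_mem.1 h0) ?_
  have hle : Submodule.span ℚ (Set.range (basisMonomials (Fin 3) ℚ ∘
      (Subtype.val : {d : Fin 3 →₀ ℕ // d.degree < s} → _))) ≤
      restrictSupport ℚ {d | d.degree < s} := by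
    rw [restrictSupport_eq_span]
    refine Submodule.span_mono ?_
    rintro _ ⟨d, rfl⟩
    exact ⟨d.1, d.2, by simp⟩
  exact (mem_restrictSupport_iff ℚ).1 (hle hf)

lemma span_boxExponents (s : ℕ) : ⊤ ≤ Submodule.span ℚ (Set.range fun t : boxExponents s =>
    Ideal.Quotient.mk (eIdeal s) (α ^ t.1.1 * β ^ t.1.2.1 * xiPoly ^ t.1.2.2)) := by
  intro x _
  obtain ⟨f, rfl⟩ := Ideal.Quotient.mk_surjective x
  refine lowerSpan_le (s := s) (W := (Submodule.span ℚ (Set.range fun t : boxExponents s =>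
    Ideal.Quotient.mk (eIdeal s) (α ^ t.1.1 * β ^ t.1.2.1 * xiPoly ^ t.1.2.2))).comap
      (Ideal.Quotient.mkₐ ℚ (eIdeal s)).toLinearMap) ?_ ?_ 0 1 (mem_lowerSpan_zero_one f)
  · intro g hg
    simp [Ideal.Quotient.eq_zero_iff_mem.2 hg]
  · exact fun i j k hi hj => Submodule.subset_span ⟨⟨(i, j, k), hi, hj⟩, rfl⟩

/-- An injection of `boxExponents s` into the exponents of degree less than `s`. -/
noncomputable def boxToExponent (s : ℕ) (t : ℕ × ℕ × ℕ) : Fin 3 →₀ ℕ :=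
  Finsupp.equivFunOnFinite.symm <|
    if t.1 + t.2.1 + 2 * t.2.2 < s then ![t.1, t.2.1, 2 * t.2.2]
    else ![s - 2 * t.2.2 - 1 - t.1, s - 2 * t.2.2 - 1 - t.2.1, 2 * t.2.2 + 1]

lemma degree_boxToExponent_lt {s : ℕ} {t : ℕ × ℕ × ℕ} (ht : t ∈ boxExponents s) :
    (boxToExponent s t).degree < s := by
  obtain ⟨h1, h2⟩ := ht
  rw [Finsupp.degree_eq_sum, Fin.sum_univ_three, boxToExponent]
  split_ifs <;> simp <;> lia

lemma boxToExponent_injOn (s : ℕ) : Set.InjOn (boxToExponent s) (boxExponents s) := by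
  rintro ⟨i, j, k⟩ ⟨h1, h2⟩ ⟨i', j', k'⟩ ⟨h1', h2'⟩ h
  have h := Finsupp.equivFunOnFinite.symm.injective h
  have e0 := congrFun h 0
  have e1 := congrFun h 1
  have e2 := congrFun h 2
  simp only [Prod.mk.injEq]
  split_ifs at e0 e1 e2 <;> simp at e0 e1 e2 h1 h2 h1' h2' <;> lia

lemma linearIndependent_boxExponents (s : ℕ) : LinearIndependent ℚ (fun t : boxExponents s =>
    Ideal.Quotient.mk (eIdeal s) (α ^ t.1.1 * β ^ t.1.2.1 * xiPoly ^ t.1.2.2)) := by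
  have hfin : (boxExponents s).Finite :=
    ((Set.finite_Iio s).prod ((Set.finite_Iio s).prod (Set.finite_Iio s))).subset
      fun t ht => ⟨by have := ht.1; simp; lia, by have := ht.2; simp; lia,
        by have := ht.1; simp; lia⟩
  have := hfin.fintype
  have : Module.Finite ℚ (MvPolynomial (Fin 3) ℚ ⧸ eIdeal s) :=
    ⟨top_le_iff.1 (span_boxExponents s) ▸ Submodule.fg_span (Set.finite_range _)⟩
  refine linearIndependent_of_top_le_span_of_card_le_finrank (span_boxExponents s) ?_
  refine LinearIndependent.fintype_card_le_finrank ((linearIndependent_monomial_mk s).comp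
    (fun t : boxExponents s => ⟨boxToExponent s t, degree_boxToExponent_lt t.2⟩) ?_)
  intro t t' h
  exact Subtype.ext (boxToExponent_injOn s t.2 t'.2 (congrArg Subtype.val h))

lemma cseq_add_three (n : ℕ) :
    ((n : MvPolynomial (Fin 3) ℚ) + 3) * cseq (n + 3) = α * cseq (n + 2) + xiPoly * eseq n := by
  rw [xiPoly_mul_eseq, cseq_eq, cseq_eq]
  push_cast
  rw [show (n : ℤ) + 3 - 2 = n + 1 by lia, add_sub_cancel_right]
  ring

lemma cseq_mem_eIdeal {s n : ℕ} (h : s + 2 ≤ n) : cseq n ∈ eIdeal s := by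
  rw [cseq_eq]
  exact sub_mem (eseq_mem_eIdeal (by lia)) (Ideal.mul_mem_left _ _ (eseq_mem_eIdeal (by lia)))

lemma exists_eq_of_mem_cIdeal {s : ℕ} {f : MvPolynomial (Fin 3) ℚ} (hf : f ∈ cIdeal (s + 1)) :
    ∃ a, ∃ b ∈ eIdeal s, f = a * cseq (s + 2) + xiPoly * b := by
  obtain ⟨A, z, hz, rfl⟩ := Ideal.mem_span_insert.1 hf
  obtain ⟨B, D, rfl⟩ := Ideal.mem_span_pair.1 hz
  have h3 := C_inv_mul_cast (σ := Fin 3) (show (s : ℚ) + 3 ≠ 0 by positivity)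
  have h4 := C_inv_mul_cast (σ := Fin 3) (show (s : ℚ) + 4 ≠ 0 by positivity)
  rw [map_add, map_natCast, map_ofNat] at h3 h4
  have r3 := cseq_add_three s
  have r4 := cseq_add_three (s + 1)
  push_cast at r4
  obtain ⟨v, hv⟩ : ∃ v : MvPolynomial (Fin 3) ℚ, v = C ((s : ℚ) + 3)⁻¹ := ⟨_, rfl⟩
  obtain ⟨w, hw⟩ : ∃ w : MvPolynomial (Fin 3) ℚ, w = C ((s : ℚ) + 4)⁻¹ := ⟨_, rfl⟩
  rw [← hv] at h3
  rw [← hw] at h4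
  have e3 : cseq (s + 3) = v * (α * cseq (s + 2) + xiPoly * eseq s) := by
    linear_combination v * r3 - cseq (s + 3) * h3
  have e4 : cseq (s + 1 + 3) = w * (α * cseq (s + 3) + xiPoly * eseq (s + 1)) := by
    linear_combination w * r4 - cseq (s + 1 + 3) * h4
  refine ⟨A + B * v * α + D * w * α * v * α,
    (B * v + D * w * α * v) * eseq s + D * w * eseq (s + 1),
    add_mem (Ideal.mul_mem_left _ _ (eseq_mem_eIdeal (by lia)))
      (Ideal.mul_mem_left _ _ (eseq_mem_eIdeal (by lia))), ?_⟩
  rw [show s + 1 + 1 = s + 2 by rfl, show s + 1 + 2 = s + 3 by rfl, e4, e3]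
  ring

/-- The evaluation `γ ↦ -αβ/2`, whose kernel is generated by `ξ`. -/
noncomputable def evalXi : MvPolynomial (Fin 3) ℚ →ₐ[ℚ] MvPolynomial (Fin 3) ℚ :=
  aeval ![α, β, -C (1 / 2 : ℚ) * (α * β)]

lemma evalXi_α : evalXi α = α := by simp [evalXi]

lemma evalXi_β : evalXi β = β := by simp [evalXi]

lemma evalXi_xiPoly : evalXi xiPoly = 0 := by
  have h : evalXi γ = -C (1 / 2 : ℚ) * (α * β) := by simp [evalXi]
  rw [xiPoly, map_add, map_mul, map_mul, evalXi_α, evalXi_β, h, map_ofNat]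
  linear_combination -(α * β) * C_half_mul_two

lemma xiPoly_ne_zero : xiPoly ≠ 0 := by
  intro h
  have := congrArg (eval (fun _ => (1 : ℚ))) h
  simp [xiPoly, map_ofNat] at this
  norm_num at this

lemma xiPoly_dvd_of_evalXi_eq_zero {f : MvPolynomial (Fin 3) ℚ} (h : evalXi f = 0) :
    xiPoly ∣ f := by
  have := sub_aeval_mem (I := Ideal.span {xiPoly}) (ψ := ![α, β, -C (1 / 2 : ℚ) * (α * β)])
    (fun i => by
      fin_cases i
      · simp
      · simp
      · refine Ideal.mem_span_singleton.2 ⟨C (1 / 2 : ℚ), ?_⟩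
        change γ - -C (1 / 2 : ℚ) * (α * β) = _
        rw [xiPoly]
        linear_combination -γ * C_half_mul_two) f
  rw [← evalXi, h, sub_zero] at this
  exact Ideal.mem_span_singleton.1 this

lemma evalXi_cseq (n : ℕ) : ∃ u : ℚ, u ≠ 0 ∧ evalXi (cseq n) = C u * α ^ n := by
  induction n using Nat.strong_induction_on with
  | _ n ih =>
  match n with
  | 0 => exact ⟨1, one_ne_zero, by simp [cseq]⟩
  | 1 => exact ⟨1, one_ne_zero, by simp [cseq, evalXi_α]⟩
  | 2 => exact ⟨1 / 2, by norm_num, by simp [cseq, evalXi]⟩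
  | k + 3 =>
    obtain ⟨u, hu, h⟩ := ih (k + 2) (by lia)
    refine ⟨((k : ℚ) + 3)⁻¹ * u, by positivity, ?_⟩
    have e := congrArg evalXi (cseq_add_three k)
    simp only [map_mul, map_add, map_natCast, map_ofNat, evalXi_α, evalXi_xiPoly, h] at e
    have hk := C_inv_mul_cast (σ := Fin 3) (show (k : ℚ) + 3 ≠ 0 by positivity)
    rw [map_add, map_natCast, map_ofNat] at hk
    rw [C_mul]
    linear_combination C ((k : ℚ) + 3)⁻¹ * e - evalXi (cseq (k + 3)) * hk

lemma coeff_eq_zero_of_sum_eq {n : ℕ} {S : Finset (ℕ × ℕ × ℕ)}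
    (hS : ∀ t ∈ S, t.1 < n ∧ t.2.2 = 0) {g : ℕ × ℕ × ℕ → ℚ} {w : MvPolynomial (Fin 3) ℚ}
    (h : ∑ t ∈ S, g t • (α ^ t.1 * β ^ t.2.1) = α ^ n * w) : ∀ t ∈ S, g t = 0 := by
  intro t ht
  have hm (t : ℕ × ℕ × ℕ) : α ^ t.1 * β ^ t.2.1 =
      monomial (Finsupp.single 0 t.1 + Finsupp.single 1 t.2.1) (1 : ℚ) := by
    rw [X_pow_eq_monomial, X_pow_eq_monomial, monomial_mul, one_mul]
  have hc := congrArg (coeff (Finsupp.single 0 t.1 + Finsupp.single 1 t.2.1)) h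
  rw [X_pow_eq_monomial, coeff_monomial_mul', if_neg (by
    rw [Finsupp.single_le_iff]
    simpa using (hS t ht).1), coeff_sum, Finset.sum_eq_single t] at hc
  · simpa [hm] using hc
  · intro t' ht' hne
    rw [coeff_smul, hm, coeff_monomial, if_neg, smul_zero]
    intro he
    have h0 := DFunLike.congr_fun he 0
    have h1 := DFunLike.congr_fun he 1
    simp at h0 h1
    exact hne (Prod.ext h0 (Prod.ext h1 ((hS t' ht').2.trans (hS t ht).2.symm)))
  · exact fun h => absurd ht h

lemma linearIndepOn_boxExponents_mk_cIdeal (s : ℕ) :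
    LinearIndepOn ℚ (fun t : ℕ × ℕ × ℕ =>
      Ideal.Quotient.mk (cIdeal (s + 1)) (α ^ t.1 * β ^ t.2.1 * xiPoly ^ t.2.2))
      (boxExponents (s + 2)) := by
  rw [linearIndepOn_iff']
  intro S g hS h
  set p := ∑ t ∈ S with t.2.2 = 0, g t • (α ^ t.1 * β ^ t.2.1) with hp
  set q := ∑ t ∈ S with ¬ t.2.2 = 0, g t • (α ^ t.1 * β ^ t.2.1 * xiPoly ^ (t.2.2 - 1)) with hq
  have hmem : p + xiPoly * q ∈ cIdeal (s + 1) := by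
    rw [← Ideal.Quotient.eq_zero_iff_mem, ← h, ← Finset.sum_filter_add_sum_filter_not S
      (fun t => t.2.2 = 0), map_add, hp, hq, Finset.mul_sum]
    simp only [← Ideal.Quotient.mkₐ_eq_mk ℚ, map_sum, map_smul]
    congr 1
    · refine Finset.sum_congr rfl fun t ht => ?_
      rw [(Finset.mem_filter.1 ht).2, pow_zero, mul_one]
    · refine Finset.sum_congr rfl fun t ht => ?_
      rw [mul_smul_comm, map_smul, mul_left_comm, mul_pow_sub_one (Finset.mem_filter.1 ht).2]
  obtain ⟨a, b, hb, e⟩ := exists_eq_of_mem_cIdeal hmem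
  obtain ⟨u, hu, hc⟩ := evalXi_cseq (s + 2)
  have hpz : evalXi p = p := by
    rw [hp]
    simp [map_sum, evalXi_α, evalXi_β]
  have e' := congrArg evalXi e
  simp only [map_add, map_mul, evalXi_xiPoly, hpz, hc] at e'
  have h0 : ∀ t ∈ S.filter (fun t => t.2.2 = 0), g t = 0 := by
    refine coeff_eq_zero_of_sum_eq (n := s + 2) (w := evalXi a * C u) (fun t ht => ?_) ?_
    · rw [Finset.mem_filter] at ht
      have := (hS ht.1).1
      exact ⟨by lia, ht.2⟩
    · rw [← hp]
      linear_combination e'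
  have hp0 : p = 0 := Finset.sum_eq_zero fun t ht => by rw [h0 t ht, zero_smul]
  have ha : evalXi a = 0 := by
    rw [hp0] at e'
    simpa [hu] using e'.symm
  obtain ⟨a', rfl⟩ := xiPoly_dvd_of_evalXi_eq_zero ha
  have hqe : q = a' * cseq (s + 2) + b := by
    refine mul_left_cancel₀ xiPoly_ne_zero ?_
    linear_combination e - hp0
  have hqm : q ∈ eIdeal s := by
    rw [hqe]
    exact add_mem (Ideal.mul_mem_left _ _ (cseq_mem_eIdeal le_rfl)) hb
  have hi : LinearIndepOn ℚ (fun t : ℕ × ℕ × ℕ =>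
      Ideal.Quotient.mk (eIdeal s) (α ^ t.1 * β ^ t.2.1 * xiPoly ^ (t.2.2 - 1)))
      {t | t ∈ boxExponents (s + 2) ∧ t.2.2 ≠ 0} :=
    (linearIndependent_boxExponents s).comp
      (fun t : {t | t ∈ boxExponents (s + 2) ∧ t.2.2 ≠ 0} =>
        ⟨(t.1.1, t.1.2.1, t.1.2.2 - 1), by
          obtain ⟨⟨i, j, k⟩, ⟨h1, h2⟩, h3⟩ := t
          constructor <;> simp at * <;> lia⟩) (by
      rintro ⟨⟨i, j, k⟩, h1, h3⟩ ⟨⟨i', j', k'⟩, h1', h3'⟩ h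
      simp at *
      lia)
  have h1 := linearIndepOn_iff'.1 hi (S.filter (fun t => ¬ t.2.2 = 0)) g
    (fun t ht => by
      have ht := Finset.mem_filter.1 ht
      exact ⟨hS ht.1, ht.2⟩) (by
    rw [← Ideal.Quotient.eq_zero_iff_mem.2 hqm, hq]
    simp only [← Ideal.Quotient.mkₐ_eq_mk ℚ, map_sum, map_smul])
  intro t ht
  by_cases hk : t.2.2 = 0
  · exact h0 t (Finset.mem_filter.2 ⟨ht, hk⟩)
  · exact h1 t (Finset.mem_filter.2 ⟨ht, hk⟩)

/-- For `m ≥ 1`, the residues modulo `I_m` of the monomials `α^i β^j ξ^k`, for triples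
`(i, j, k)` with `i + 2k ≤ m`, `j + 2k ≤ m`, and `j < ⌊m/2⌋` whenever `k = 0`, are linearly
independent in `ℚ[α, β, γ]/I_m`. -/
theorem monomials_linearIndependent_in_quotient (m : ℕ) (hm : 1 ≤ m) :
    LinearIndependent ℚ
      (fun t : {t : ℕ × ℕ × ℕ //
          t.1 + 2 * t.2.2 ≤ m ∧ t.2.1 + 2 * t.2.2 ≤ m ∧ (t.2.2 = 0 → t.2.1 < m / 2)} =>
        Ideal.Quotient.mk (cIdeal m) (X 0 ^ t.1.1 * X 1 ^ t.1.2.1 * xiPoly ^ t.1.2.2)) := by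
  obtain ⟨s, rfl⟩ := Nat.exists_eq_add_of_le' hm
  exact (linearIndepOn_boxExponents_mk_cIdeal s).mono fun t ht =>
    ⟨Nat.lt_succ_of_le ht.1, Nat.lt_succ_of_le ht.2.1⟩
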